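/- arXiv:2512.13305 — 7 statements merged into one kernel-verified Lean document; each statement's English description precedes it below -/
import Mathlib

section
/- For every y ∈ ℝ one has ∫_ℝ e^{-|x−y| − |x| + |y|} dx = 1 + |y|. In particular, this integral is unbounded in y, so the uniform kernel bound of Lemma 2.6 fails for α = 1. -/
open MeasureTheory

theorem stmt2_aux (y : ℝ) (hy : 0 ≤ y) :
    (∫ x : ℝ, Real.exp (-|x - y| - |x| + |y|)) = 1 + |y| := by
  have e1 : Set.EqOn (fun x : ℝ => Real.exp (-|x - y| - |x| + |y|))
      (fun x => Real.exp (2 * x)) (Set.Iic 0) := by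
    intro x hx
    have hx : x ≤ 0 := hx
    simp only
    rw [abs_of_nonpos hx, abs_of_nonneg hy, abs_of_nonpos (by linarith)]
    congr 1; ring
  have e2 : Set.EqOn (fun x : ℝ => Real.exp (-|x - y| - |x| + |y|))
      (fun _ => (1:ℝ)) (Set.Ioc 0 y) := by
    intro x hx
    obtain ⟨h1, h2⟩ := hx
    simp only
    rw [abs_of_pos h1, abs_of_nonneg hy, abs_of_nonpos (by linarith), ← Real.exp_zero]
    congr 1; ring
  have e3 : Set.EqOn (fun x : ℝ => Real.exp (-|x - y| - |x| + |y|))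
      (fun x => Real.exp (2 * y) * Real.exp (-2 * x)) (Set.Ioi y) := by
    intro x hx
    have hx : y < x := hx
    simp only
    rw [abs_of_pos (by linarith : 0 < x), abs_of_nonneg hy, abs_of_pos (by linarith),
      ← Real.exp_add]
    congr 1; ring
  have i1 := (integrableOn_congr_fun (μ := volume) e1 measurableSet_Iic).2
    (integrableOn_exp_mul_Iic (by norm_num) 0)
  have i2 := (integrableOn_congr_fun (μ := volume) e2 measurableSet_Ioc).2
    (integrableOn_const (by simp))
  have i3 := (integrableOn_congr_fun (μ := volume) e3 measurableSet_Ioi).2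
    ((integrableOn_exp_mul_Ioi (by norm_num) y).const_mul _)
  have i23 := i2.union i3
  rw [Set.Ioc_union_Ioi_eq_Ioi hy] at i23
  rw [← intervalIntegral.integral_Iic_add_Ioi i1 i23, ← Set.Ioc_union_Ioi_eq_Ioi hy,
    setIntegral_union (Set.Ioc_disjoint_Ioi le_rfl) measurableSet_Ioi i2 i3,
    setIntegral_congr_fun measurableSet_Iic e1, setIntegral_congr_fun measurableSet_Ioc e2,
    setIntegral_congr_fun measurableSet_Ioi e3, integral_const_mul,
    integral_exp_mul_Iic (by norm_num), integral_exp_mul_Ioi (by norm_num)]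
  have : Real.exp (2 * y) * Real.exp (-2 * y) = 1 := by
    rw [← Real.exp_add, ← Real.exp_zero]; congr 1; ring
  simp [hy, abs_of_nonneg hy] at this ⊢
  linarith

/-- **Remark 2.7**: for every `y ∈ ℝ`,
`∫ e^{-|x-y| - |x| + |y|} dx = 1 + |y|`; in particular the integral
is unbounded in `y`, so the uniform kernel bound fails for `α = 1`. -/
theorem stmt2 :
    (∀ y : ℝ, (∫ x : ℝ, Real.exp (-|x - y| - |x| + |y|)) = 1 + |y|) ∧
    (∀ C : ℝ, ∃ y : ℝ, C < ∫ x : ℝ, Real.exp (-|x - y| - |x| + |y|)) := by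
  have main : ∀ y : ℝ, (∫ x : ℝ, Real.exp (-|x - y| - |x| + |y|)) = 1 + |y| := by
    intro y
    rcases le_total 0 y with hy | hy
    · exact stmt2_aux y hy
    · have h := stmt2_aux (-y) (by linarith)
      rw [← integral_neg_eq_self, abs_neg] at h
      rw [← h]
      congr 1
      ext x
      rw [abs_neg x, ← abs_neg (x - y)]
      congr 5; ring
  refine ⟨main, fun C => ⟨C, ?_⟩⟩
  rw [main]
  linarith [le_abs_self C]
end

section
/- Let n, m be natural numbers, let A : ℝ → Matrix (Fin n) (Fin n) ℝ be continuous, and let M : ℝ → Matrix (Fin n) (Fin m) ℝ be differentiable (entrywise) with M′(t) = A(t) · M(t) for all t ∈ ℝ. Then for every t ∈ ℝ the rank of M(t) equals the rank of M(0). -/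
open Set in
attribute [local instance] Matrix.linftyOpNormedAddCommGroup in
lemma stmt3_aux (n : ℕ) (A : ℝ → Matrix (Fin n) (Fin n) ℝ)
    (hA : ∀ i j, Continuous fun t => A t i j) (x : ℝ → Fin n → ℝ)
    (hx : ∀ t, HasDerivAt x ((A t).mulVec (x t)) t) (t₀ : ℝ) (h0 : x t₀ = 0) (t : ℝ) :
    x t = 0 := by
  have hAc : Continuous A := continuous_matrix hA
  have hN : Continuous fun t => ‖A t‖₊ := hAc.nnnorm
  obtain ⟨K, hK⟩ := (isCompact_Icc (a := min t t₀ - 1) (b := max t t₀ + 1)).bddAbove_image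
    hN.continuousOn
  have key : EqOn x (fun _ => 0) (Ioo (min t t₀ - 1) (max t t₀ + 1)) := by
    refine ODE_solution_unique_of_mem_Ioo (v := fun t y => (A t).mulVec y) (s := fun _ => univ)
      (K := K) (t₀ := t₀) ?_ ?_ ?_ ?_ ?_
    · intro s hs
      refine LipschitzOnWith.of_dist_le_mul fun y _ z _ => ?_
      rw [dist_eq_norm, dist_eq_norm, ← Matrix.mulVec_sub]
      refine (Matrix.linfty_opNorm_mulVec _ _).trans ?_
      gcongr
      exact_mod_cast hK ⟨s, Ioo_subset_Icc_self hs, rfl⟩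
    · constructor <;> grind
    · exact fun s _ => ⟨hx s, mem_univ _⟩
    · intro s _
      refine ⟨?_, mem_univ _⟩
      simpa using hasDerivAt_const s (0 : Fin n → ℝ)
    · exact h0
  exact key (by constructor <;> grind)

/-- **Lemma 3.1**: if `M : ℝ → Matrix (Fin n) (Fin m) ℝ` is (entrywise)
differentiable and satisfies the linear homogeneous matrix ODE
`M′(t) = A(t) * M(t)` with `A` continuous, then the rank of `M(t)`
equals the rank of `M(0)` for every `t`. -/
theorem stmt3 (n m : ℕ) (A : ℝ → Matrix (Fin n) (Fin n) ℝ)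
    (M : ℝ → Matrix (Fin n) (Fin m) ℝ)
    (hA : ∀ i j, Continuous fun t => A t i j)
    (hM : ∀ t i j, HasDerivAt (fun s => M s i j) ((A t * M t) i j) t) :
    ∀ t : ℝ, (M t).rank = (M 0).rank := by
  intro t
  have hx : ∀ v : Fin m → ℝ, ∀ t, HasDerivAt (fun s => (M s).mulVec v)
      ((A t).mulVec ((M t).mulVec v)) t := by
    intro v t
    rw [hasDerivAt_pi]
    intro i
    rw [Matrix.mulVec_mulVec]
    simp only [Matrix.mulVec, dotProduct]
    exact HasDerivAt.fun_sum fun j _ => (hM t i j).mul_const (v j)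
  have hker : LinearMap.ker (M t).mulVecLin = LinearMap.ker (M 0).mulVecLin := by
    ext v
    simp only [LinearMap.mem_ker, Matrix.mulVecLin_apply]
    exact ⟨fun h => stmt3_aux n A hA _ (hx v) t h 0, fun h => stmt3_aux n A hA _ (hx v) 0 h t⟩
  have h1 := (M t).mulVecLin.finrank_range_add_finrank_ker
  have h2 := (M 0).mulVecLin.finrank_range_add_finrank_ker
  rw [hker] at h1
  unfold Matrix.rank
  omega
end

section
/- Assume the Bressan–Constantin differential relations (see context) and suppose W(ξ₁) = π at some point ξ₁ ∈ ℝ. Then U′(ξ₁) = 0, V′(ξ₁) = 0, V″(ξ₁) = 0, y′(ξ₁) = 0, y″(ξ₁) = 0, and moreover U″(ξ₁) = −(1/2) q(ξ₁) W′(ξ₁) cos²(Z(ξ₁)/2), V‴(ξ₁) = (1/4) q(ξ₁) W′(ξ₁)² sin(Z(ξ₁)), and y‴(ξ₁) = (1/2) q(ξ₁) W′(ξ₁)² cos²(Z(ξ₁)/2). -/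
open Real

theorem aux_sq (g A c : ℝ → ℝ) (hA : ContDiff ℝ (⊤ : ℕ∞) A) (hc : ContDiff ℝ (⊤ : ℕ∞) c)
    (hg : ∀ ξ, deriv g ξ = A ξ * c ξ ^ 2) (x : ℝ) (hx : c x = 0) :
    iteratedDeriv 1 g x = 0 ∧ iteratedDeriv 2 g x = 0 ∧
      iteratedDeriv 3 g x = 2 * A x * (deriv c x) ^ 2 := by
  have dA : Differentiable ℝ A := hA.differentiable (by simp)
  have dc : Differentiable ℝ c := hc.differentiable (by simp)
  have dA' : Differentiable ℝ (deriv A) :=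
    (contDiff_infty_iff_deriv.1 hA).2.differentiable (by simp)
  have dc' : Differentiable ℝ (deriv c) :=
    (contDiff_infty_iff_deriv.1 hc).2.differentiable (by simp)
  have h1 : deriv g = fun ξ => A ξ * c ξ ^ 2 := funext hg
  have h2 : deriv (deriv g) = fun ξ => c ξ * (deriv A ξ * c ξ + 2 * A ξ * deriv c ξ) := by
    rw [h1]
    funext ξ
    have := ((dA ξ).hasDerivAt.mul ((dc ξ).hasDerivAt.pow 2)).deriv
    refine Eq.trans this ?_
    simp
    ring
  have h3 : deriv (deriv (deriv g)) x = 2 * A x * (deriv c x) ^ 2 := by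
    rw [h2]
    have hd : DifferentiableAt ℝ (fun ξ => deriv A ξ * c ξ + 2 * A ξ * deriv c ξ) x := by
      fun_prop
    have := ((dc x).hasDerivAt.mul hd.hasDerivAt).deriv
    refine Eq.trans this ?_
    simp only [hx]
    ring
  refine ⟨?_, ?_, ?_⟩
  · rw [iteratedDeriv_one, hg, hx]; ring
  · rw [iteratedDeriv_succ, iteratedDeriv_one, h2]; simp [hx]
  · rw [iteratedDeriv_succ, iteratedDeriv_succ, iteratedDeriv_one, h3]

/-- Case (1) of the proof of Theorem 1.2: Bressan–Constantin variables
`q, W, Z` smooth, `U, V, y` satisfying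
`y′ = q cos²(W/2) cos²(Z/2)`, `U′ = (q/2) sin W cos²(Z/2)`,
`V′ = (q/2) cos²(W/2) sin Z`.  At a point `ξ₁` with `W ξ₁ = π`:
`U′ = V′ = V″ = y′ = y″ = 0`,
`U″ = -(1/2) q W′ cos²(Z/2)`, `V‴ = (1/4) q (W′)² sin Z`,
`y‴ = (1/2) q (W′)² cos²(Z/2)` at `ξ₁`. -/
theorem stmt7 (q W Z U V y : ℝ → ℝ)
    (hq : ContDiff ℝ (⊤ : ℕ∞) q) (hW : ContDiff ℝ (⊤ : ℕ∞) W) (hZ : ContDiff ℝ (⊤ : ℕ∞) Z)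
    (hy : ∀ ξ, deriv y ξ = q ξ * Real.cos (W ξ / 2) ^ 2 * Real.cos (Z ξ / 2) ^ 2)
    (hU : ∀ ξ, deriv U ξ = q ξ / 2 * Real.sin (W ξ) * Real.cos (Z ξ / 2) ^ 2)
    (hV : ∀ ξ, deriv V ξ = q ξ / 2 * Real.cos (W ξ / 2) ^ 2 * Real.sin (Z ξ))
    (ξ₁ : ℝ) (hWπ : W ξ₁ = π) :
    iteratedDeriv 1 U ξ₁ = 0 ∧ iteratedDeriv 1 V ξ₁ = 0 ∧
    iteratedDeriv 2 V ξ₁ = 0 ∧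
    iteratedDeriv 1 y ξ₁ = 0 ∧ iteratedDeriv 2 y ξ₁ = 0 ∧
    iteratedDeriv 2 U ξ₁
      = -(1 / 2) * q ξ₁ * deriv W ξ₁ * Real.cos (Z ξ₁ / 2) ^ 2 ∧
    iteratedDeriv 3 V ξ₁
      = (1 / 4) * q ξ₁ * (deriv W ξ₁) ^ 2 * Real.sin (Z ξ₁) ∧
    iteratedDeriv 3 y ξ₁
      = (1 / 2) * q ξ₁ * (deriv W ξ₁) ^ 2 * Real.cos (Z ξ₁ / 2) ^ 2 := by
  have dW : Differentiable ℝ W := hW.differentiable (by simp)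
  have cc : ContDiff ℝ (⊤ : ℕ∞) (fun ξ => Real.cos (W ξ / 2)) := by fun_prop
  have c0 : Real.cos (W ξ₁ / 2) = 0 := by rw [hWπ]; exact Real.cos_pi_div_two
  have c1 : deriv (fun ξ => Real.cos (W ξ / 2)) ξ₁ = -(deriv W ξ₁ / 2) := by
    rw [(((dW ξ₁).hasDerivAt.div_const 2).cos).deriv, hWπ, Real.sin_pi_div_two]
    ring
  obtain ⟨v1, v2, v3⟩ := aux_sq V (fun ξ => q ξ / 2 * Real.sin (Z ξ)) _ (by fun_prop) cc
    (fun ξ => by rw [hV]; ring) ξ₁ c0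
  obtain ⟨y1, y2, y3⟩ := aux_sq y (fun ξ => q ξ * Real.cos (Z ξ / 2) ^ 2) _ (by fun_prop) cc
    (fun ξ => by rw [hy]; ring) ξ₁ c0
  refine ⟨?_, v1, v2, y1, y2, ?_, ?_, ?_⟩
  · rw [iteratedDeriv_one, hU, hWπ]; simp
  · have hB : ContDiff ℝ (⊤ : ℕ∞) (fun ξ => q ξ / 2 * Real.cos (Z ξ / 2) ^ 2) := by fun_prop
    have dB := (hB.differentiable (by simp) ξ₁).hasDerivAt
    have e : deriv U = fun ξ => (q ξ / 2 * Real.cos (Z ξ / 2) ^ 2) * Real.sin (W ξ) := by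
      funext ξ; rw [hU]; ring
    rw [iteratedDeriv_succ, iteratedDeriv_one, e]
    refine Eq.trans (dB.mul (dW ξ₁).hasDerivAt.sin).deriv ?_
    rw [hWπ, Real.sin_pi, Real.cos_pi]
    ring
  · rw [v3, c1]; ring
  · rw [y3, c1]; ring
end

section
/- Assume the Bressan–Constantin differential relations (see context) and suppose Z(ξ₂) = π at some point ξ₂ ∈ ℝ. Then U′(ξ₂) = 0, U″(ξ₂) = 0, V′(ξ₂) = 0, y′(ξ₂) = 0, y″(ξ₂) = 0, and moreover U‴(ξ₂) = (1/4) q(ξ₂) Z′(ξ₂)² sin(W(ξ₂)), V″(ξ₂) = −(1/2) q(ξ₂) Z′(ξ₂) cos²(W(ξ₂)/2), and y‴(ξ₂) = (1/2) q(ξ₂) Z′(ξ₂)² cos²(W(ξ₂)/2). -/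
open Real

lemma aux_sq_s8 (a c : ℝ → ℝ) (ha : ContDiff ℝ (⊤ : ℕ∞) a) (hc : ContDiff ℝ (⊤ : ℕ∞) c)
    (x : ℝ) (h0 : c x = 0) :
    deriv (fun t => a t * c t ^ 2) x = 0 ∧
    deriv (deriv (fun t => a t * c t ^ 2)) x = 2 * a x * deriv c x ^ 2 := by
  have da : Differentiable ℝ a := ha.differentiable (by simp)
  have dc : Differentiable ℝ c := hc.differentiable (by simp)
  have da' : Differentiable ℝ (deriv a) :=
    (contDiff_infty_iff_deriv.1 ha).2.differentiable (by simp)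
  have dc' : Differentiable ℝ (deriv c) :=
    (contDiff_infty_iff_deriv.1 hc).2.differentiable (by simp)
  have h1 : deriv (fun t => a t * c t ^ 2) =
      fun t => c t * (deriv a t * c t + 2 * a t * deriv c t) := by
    funext t
    have := (da t).hasDerivAt.mul ((dc t).hasDerivAt.pow 2)
    refine (this.congr_deriv ?_).deriv
    simp
    ring
  refine ⟨by rw [h1]; simp [h0], ?_⟩
  rw [h1]
  have dg : Differentiable ℝ (fun t => deriv a t * c t + 2 * a t * deriv c t) := by fun_prop
  have := (dc x).hasDerivAt.mul (dg x).hasDerivAt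
  refine (this.congr_deriv ?_).deriv
  simp [h0]
  ring

/-- Case (2) of the proof of Theorem 1.2: at a point `ξ₂` with `Z ξ₂ = π`:
`U′ = U″ = V′ = y′ = y″ = 0`,
`U‴ = (1/4) q (Z′)² sin W`, `V″ = -(1/2) q Z′ cos²(W/2)`,
`y‴ = (1/2) q (Z′)² cos²(W/2)` at `ξ₂`. -/
theorem stmt8 (q W Z U V y : ℝ → ℝ)
    (hq : ContDiff ℝ (⊤ : ℕ∞) q) (hW : ContDiff ℝ (⊤ : ℕ∞) W) (hZ : ContDiff ℝ (⊤ : ℕ∞) Z)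
    (hy : ∀ ξ, deriv y ξ = q ξ * Real.cos (W ξ / 2) ^ 2 * Real.cos (Z ξ / 2) ^ 2)
    (hU : ∀ ξ, deriv U ξ = q ξ / 2 * Real.sin (W ξ) * Real.cos (Z ξ / 2) ^ 2)
    (hV : ∀ ξ, deriv V ξ = q ξ / 2 * Real.cos (W ξ / 2) ^ 2 * Real.sin (Z ξ))
    (ξ₂ : ℝ) (hZπ : Z ξ₂ = π) :
    iteratedDeriv 1 U ξ₂ = 0 ∧ iteratedDeriv 2 U ξ₂ = 0 ∧
    iteratedDeriv 1 V ξ₂ = 0 ∧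
    iteratedDeriv 1 y ξ₂ = 0 ∧ iteratedDeriv 2 y ξ₂ = 0 ∧
    iteratedDeriv 3 U ξ₂
      = (1 / 4) * q ξ₂ * (deriv Z ξ₂) ^ 2 * Real.sin (W ξ₂) ∧
    iteratedDeriv 2 V ξ₂
      = -(1 / 2) * q ξ₂ * deriv Z ξ₂ * Real.cos (W ξ₂ / 2) ^ 2 ∧
    iteratedDeriv 3 y ξ₂
      = (1 / 2) * q ξ₂ * (deriv Z ξ₂) ^ 2 * Real.cos (W ξ₂ / 2) ^ 2 := by
  have dZ : Differentiable ℝ Z := hZ.differentiable (by simp)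
  have c0 : Real.cos (Z ξ₂ / 2) = 0 := by rw [hZπ]; exact Real.cos_pi_div_two
  have hc : ContDiff ℝ (⊤ : ℕ∞) (fun t => Real.cos (Z t / 2)) :=
    Real.contDiff_cos.comp (hZ.div_const 2)
  have hcW : ContDiff ℝ (⊤ : ℕ∞) (fun t => Real.cos (W t / 2)) :=
    Real.contDiff_cos.comp (hW.div_const 2)
  have hsW : ContDiff ℝ (⊤ : ℕ∞) (fun t => Real.sin (W t)) :=
    Real.contDiff_sin.comp hW
  have dc : deriv (fun t => Real.cos (Z t / 2)) ξ₂ = -(deriv Z ξ₂ / 2) := by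
    have := ((dZ ξ₂).hasDerivAt.div_const 2).cos
    rw [this.deriv, hZπ, Real.sin_pi_div_two]; ring
  have hU' := funext hU
  have hV' := funext hV
  have hy' := funext hy
  obtain ⟨u1, u2⟩ := aux_sq_s8 (fun t => q t / 2 * Real.sin (W t)) _
    ((hq.div_const 2).mul hsW) hc ξ₂ c0
  obtain ⟨y1, y2⟩ := aux_sq_s8 (fun t => q t * Real.cos (W t / 2) ^ 2) _
    (hq.mul (hcW.pow 2)) hc ξ₂ c0
  simp only [iteratedDeriv_succ, iteratedDeriv_zero]
  rw [hU', hV', hy']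
  refine ⟨by simp [c0], u1, by simp [hZπ], by simp [c0], y1, ?_, ?_, ?_⟩
  · rw [u2, dc]; ring
  · have dA : Differentiable ℝ (fun t => q t / 2 * Real.cos (W t / 2) ^ 2) :=
      ((hq.div_const 2).mul (hcW.pow 2)).differentiable (by simp)
    have := (dA ξ₂).hasDerivAt.mul (dZ ξ₂).hasDerivAt.sin
    refine (this.congr_deriv ?_).deriv
    simp [hZπ]
    ring
  · rw [y2, dc]; ring
end

section
/- Assume the Bressan–Constantin differential relations (see context) and suppose W(ξ₃) = π and Z(ξ₃) = π at some point ξ₃ ∈ ℝ. Then ∂^i U(ξ₃) = 0 and ∂^i V(ξ₃) = 0 for i = 1, 2, 3; ∂^4 U(ξ₃) = −(3/4) q(ξ₃) W′(ξ₃) Z′(ξ₃)²; ∂^4 V(ξ₃) = −(3/4) q(ξ₃) W′(ξ₃)² Z′(ξ₃); ∂^i y(ξ₃) = 0 for i = 1, 2, 3, 4; and ∂^5 y(ξ₃) = (3/2) q(ξ₃) W′(ξ₃)² Z′(ξ₃)². -/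
open Real

def VanOrd (x : ℝ) (n : ℕ) (c : ℝ) (f : ℝ → ℝ) : Prop :=
  ContDiff ℝ (⊤ : ℕ∞) f ∧ (∀ i < n, iteratedDeriv i f x = 0) ∧
    iteratedDeriv n f x = c * (n.factorial : ℝ)

theorem VanOrd.mul {x : ℝ} {n m : ℕ} {a b : ℝ} {f g : ℝ → ℝ}
    (hf : VanOrd x n a f) (hg : VanOrd x m b g) :
    VanOrd x (n + m) (a * b) (fun t => f t * g t) := by
  obtain ⟨sf, zf, vf⟩ := hf
  obtain ⟨sg, zg, vg⟩ := hg
  have key : ∀ k, iteratedDeriv k (fun t => f t * g t) x =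
      ∑ i ∈ Finset.range (k + 1), (k.choose i : ℝ) * iteratedDeriv i f x *
        iteratedDeriv (k - i) g x := by
    intro k
    exact iteratedDeriv_fun_mul ((sf.of_le (by exact_mod_cast le_top)).contDiffAt)
      ((sg.of_le (by exact_mod_cast le_top)).contDiffAt)
  refine ⟨sf.mul sg, ?_, ?_⟩
  · intro k hk
    rw [key]
    apply Finset.sum_eq_zero
    intro i hi
    have := Finset.mem_range.1 hi
    by_cases h : i < n
    · rw [zf i h]; ring
    · rw [zg (k - i) (by omega)]; ring
  · rw [key, Finset.sum_eq_single n]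
    · rw [vf, Nat.add_sub_cancel_left, vg]
      have := Nat.add_choose_mul_factorial_mul_factorial n m
      rw [← Nat.choose_symm_add] at this
      have h2 : (((n + m).choose n : ℕ) : ℝ) * n.factorial * m.factorial
          = ((n + m).factorial : ℝ) := by exact_mod_cast this
      rw [← h2]; ring
    · intro i hi hne
      have := Finset.mem_range.1 hi
      by_cases h : i < n
      · rw [zf i h]; ring
      · rw [zg (n + m - i) (by omega)]; ring
    · intro h
      exact absurd (Finset.mem_range.2 (by omega)) h

theorem VanOrd.zero {x : ℝ} {f : ℝ → ℝ} (hf : ContDiff ℝ (⊤ : ℕ∞) f) :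
    VanOrd x 0 (f x) f := ⟨hf, by simp, by simp⟩

theorem VanOrd.one {x c : ℝ} {f : ℝ → ℝ} (hf : ContDiff ℝ (⊤ : ℕ∞) f)
    (h0 : f x = 0) (h1 : HasDerivAt f c x) : VanOrd x 1 c f := by
  refine ⟨hf, ?_, ?_⟩
  · intro i hi
    obtain rfl : i = 0 := by omega
    simpa using h0
  · simp [iteratedDeriv_one, h1.deriv]

theorem VanOrd.fin {x c : ℝ} {n : ℕ} {f F : ℝ → ℝ} (h : VanOrd x n c f)
    (hF : ∀ t, deriv F t = f t) :
    (∀ i : ℕ, 1 ≤ i → i ≤ n → iteratedDeriv i F x = 0) ∧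
      iteratedDeriv (n + 1) F x = c * (n.factorial : ℝ) := by
  have e : deriv F = f := funext hF
  constructor
  · intro i h1 h2
    obtain ⟨j, rfl⟩ := Nat.exists_eq_add_of_le' h1
    rw [iteratedDeriv_succ', e]
    exact h.2.1 j (by omega)
  · rw [iteratedDeriv_succ', e]
    exact h.2.2

theorem vanOrd_cos {W : ℝ → ℝ} {x : ℝ} (hW : ContDiff ℝ (⊤ : ℕ∞) W) (h : W x = π) :
    VanOrd x 1 (-(deriv W x / 2)) (fun t => Real.cos (W t / 2)) := by
  have d : HasDerivAt W (deriv W x) x :=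
    (hW.differentiable (by simp)).differentiableAt.hasDerivAt
  refine VanOrd.one (by fun_prop) (by simp [h]) ?_
  have := (d.div_const 2).cos
  rw [h, Real.sin_pi_div_two] at this
  convert this using 1
  ring

theorem vanOrd_sin {W : ℝ → ℝ} {x : ℝ} (hW : ContDiff ℝ (⊤ : ℕ∞) W) (h : W x = π) :
    VanOrd x 1 (-(deriv W x)) (fun t => Real.sin (W t)) := by
  have d : HasDerivAt W (deriv W x) x :=
    (hW.differentiable (by simp)).differentiableAt.hasDerivAt
  refine VanOrd.one (by fun_prop) (by simp [h]) ?_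
  have := d.sin
  rw [h, Real.cos_pi] at this
  convert this using 1
  ring

/-- Case (3) of the proof of Theorem 1.2: at a point `ξ₃` with
`W ξ₃ = π` and `Z ξ₃ = π`:
`∂^i U = ∂^i V = 0` for `i = 1,2,3`,
`∂^4 U = -(3/4) q W′ (Z′)²`, `∂^4 V = -(3/4) q (W′)² Z′`,
`∂^i y = 0` for `i = 1,…,4`, and `∂^5 y = (3/2) q (W′)² (Z′)²` at `ξ₃`. -/
theorem stmt9 (q W Z U V y : ℝ → ℝ)
    (hq : ContDiff ℝ (⊤ : ℕ∞) q) (hW : ContDiff ℝ (⊤ : ℕ∞) W) (hZ : ContDiff ℝ (⊤ : ℕ∞) Z)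
    (hy : ∀ ξ, deriv y ξ = q ξ * Real.cos (W ξ / 2) ^ 2 * Real.cos (Z ξ / 2) ^ 2)
    (hU : ∀ ξ, deriv U ξ = q ξ / 2 * Real.sin (W ξ) * Real.cos (Z ξ / 2) ^ 2)
    (hV : ∀ ξ, deriv V ξ = q ξ / 2 * Real.cos (W ξ / 2) ^ 2 * Real.sin (Z ξ))
    (ξ₃ : ℝ) (hWπ : W ξ₃ = π) (hZπ : Z ξ₃ = π) :
    (∀ i : ℕ, 1 ≤ i → i ≤ 3 → iteratedDeriv i U ξ₃ = 0) ∧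
    (∀ i : ℕ, 1 ≤ i → i ≤ 3 → iteratedDeriv i V ξ₃ = 0) ∧
    iteratedDeriv 4 U ξ₃
      = -(3 / 4) * q ξ₃ * deriv W ξ₃ * (deriv Z ξ₃) ^ 2 ∧
    iteratedDeriv 4 V ξ₃
      = -(3 / 4) * q ξ₃ * (deriv W ξ₃) ^ 2 * deriv Z ξ₃ ∧
    (∀ i : ℕ, 1 ≤ i → i ≤ 4 → iteratedDeriv i y ξ₃ = 0) ∧
    iteratedDeriv 5 y ξ₃
      = (3 / 2) * q ξ₃ * (deriv W ξ₃) ^ 2 * (deriv Z ξ₃) ^ 2 := by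
  have cW := vanOrd_cos hW hWπ
  have cZ := vanOrd_cos hZ hZπ
  have sW := vanOrd_sin hW hWπ
  have sZ := vanOrd_sin hZ hZπ
  have q0 := VanOrd.zero (x := ξ₃) hq
  have q1 := VanOrd.zero (x := ξ₃) (f := fun t => q t / 2) (by fun_prop)
  obtain ⟨y1, y2⟩ := ((q0.mul (cW.mul cW)).mul (cZ.mul cZ)).fin (F := y)
    (fun t => by rw [hy]; ring)
  obtain ⟨u1, u2⟩ := ((q1.mul sW).mul (cZ.mul cZ)).fin (F := U)
    (fun t => by rw [hU]; ring)
  obtain ⟨v1, v2⟩ := ((q1.mul (cW.mul cW)).mul sZ).fin (F := V)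
    (fun t => by rw [hV]; ring)
  norm_num [Nat.factorial] at y1 y2 u1 u2 v1 v2
  refine ⟨u1, v1, ?_, ?_, y1, ?_⟩
  · rw [u2]; ring
  · rw [v2]; ring
  · rw [y2]; ring
end

section
/- Assume the Bressan–Constantin differential relations (see context) and suppose Z(ξ₅) = π and Z′(ξ₅) = 0 at some point ξ₅ ∈ ℝ. Then ∂^i U(ξ₅) = 0 for i = 1, 2, 3, 4; V′(ξ₅) = V″(ξ₅) = 0; ∂^5 U(ξ₅) = (3/4) q(ξ₅) Z″(ξ₅)² sin(W(ξ₅)); V‴(ξ₅) = −(1/2) q(ξ₅) Z″(ξ₅) cos²(W(ξ₅)/2); ∂^i y(ξ₅) = 0 for i = 1, 2, 3, 4; and ∂^5 y(ξ₅) = (3/2) q(ξ₅) Z″(ξ₅)² cos²(W(ξ₅)/2). -/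
open Real

lemma aux_comp (Z g g1 g2 : ℝ → ℝ) (hZ : ContDiff ℝ (⊤ : ℕ∞) Z) (x : ℝ) (hZ' : deriv Z x = 0)
    (hg : ∀ t, HasDerivAt g (g1 t) t) (hg1 : ∀ t, HasDerivAt g1 (g2 t) t) :
    iteratedDeriv 1 (fun t => g (Z t)) x = 0 ∧
    iteratedDeriv 2 (fun t => g (Z t)) x = g1 (Z x) * iteratedDeriv 2 Z x := by
  have hd : Differentiable ℝ Z := hZ.differentiable (by simp)
  have hZ1 : ContDiff ℝ 1 (deriv Z) := by
    have h2 : ContDiff ℝ (1 + 1) Z := by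
      have h3 := contDiff_infty.1 hZ (1 + 1)
      exact_mod_cast h3
    exact (contDiff_succ_iff_deriv.1 h2).2.2
  have hd1 : Differentiable ℝ (deriv Z) := hZ1.differentiable (by simp)
  have e1 : deriv (fun t => g (Z t)) = fun t => g1 (Z t) * deriv Z t := by
    funext t
    exact ((hg (Z t)).comp t (hd t).hasDerivAt).deriv
  constructor
  · rw [iteratedDeriv_one, e1]; simp [hZ']
  · rw [iteratedDeriv_succ', iteratedDeriv_one, e1, iteratedDeriv_succ', iteratedDeriv_one]
    have := (((hg1 (Z x)).comp x (hd x).hasDerivAt).mul (hd1 x).hasDerivAt).deriv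
    simp only [hZ', mul_zero, zero_mul, zero_add] at this
    exact this

lemma aux_mul (f S : ℝ → ℝ) (hf : ContDiff ℝ (⊤ : ℕ∞) f) (hS : ContDiff ℝ (⊤ : ℕ∞) S) (x : ℝ)
    (n : ℕ) (h : ∀ k < n, iteratedDeriv k S x = 0) :
    (∀ k < n, iteratedDeriv k (fun t => f t * S t) x = 0) ∧
    iteratedDeriv n (fun t => f t * S t) x = f x * iteratedDeriv n S x := by
  have key : ∀ k, iteratedDeriv k (fun t => f t * S t) x = ∑ i ∈ Finset.range (k + 1),
      (k.choose i : ℝ) * iteratedDeriv i f x * iteratedDeriv (k - i) S x := by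
    intro k
    exact iteratedDeriv_fun_mul (hf.contDiffAt.of_le (by exact_mod_cast le_top))
      (hS.contDiffAt.of_le (by exact_mod_cast le_top))
  constructor
  · intro k hk
    rw [key]
    apply Finset.sum_eq_zero
    intro i _
    rw [h _ (by omega), mul_zero]
  · rw [key, Finset.sum_eq_single 0]
    · simp
    · intro i hi h0
      simp at hi
      rw [h _ (by omega), mul_zero]
    · simp

lemma aux_sq_s11 (C : ℝ → ℝ) (hC : ContDiff ℝ (⊤ : ℕ∞) C) (x : ℝ)
    (h0 : C x = 0) (h1 : iteratedDeriv 1 C x = 0) :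
    (∀ k < 4, iteratedDeriv k (fun t => C t ^ 2) x = 0) ∧
    iteratedDeriv 4 (fun t => C t ^ 2) x = 6 * iteratedDeriv 2 C x ^ 2 := by
  have key : ∀ k, iteratedDeriv k (fun t => C t ^ 2) x = ∑ i ∈ Finset.range (k + 1),
      (k.choose i : ℝ) * iteratedDeriv i C x * iteratedDeriv (k - i) C x := by
    intro k
    simp only [pow_two]
    exact iteratedDeriv_fun_mul (hC.contDiffAt.of_le (by exact_mod_cast le_top))
      (hC.contDiffAt.of_le (by exact_mod_cast le_top))
  have h0' : iteratedDeriv 0 C x = 0 := by simpa using h0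
  constructor
  · intro k hk
    rw [key]
    interval_cases k <;> simp only [Finset.sum_range_succ, Finset.sum_range_zero, Nat.sub_self, Nat.sub_zero, Nat.reduceSub, h0', h1] <;> ring
  · rw [key]
    have : Nat.choose 4 2 = 6 := rfl
    simp only [Finset.sum_range_succ, Finset.sum_range_zero, Nat.sub_self, Nat.sub_zero, Nat.reduceSub, h0', h1, this]
    push_cast
    ring

/-- Case (5) of the proof of Theorem 1.2: at a point `ξ₅` with
`Z ξ₅ = π` and `Z′ ξ₅ = 0`:
`∂^i U = 0` for `i = 1,…,4`, `V′ = V″ = 0`,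
`∂^5 U = (3/4) q (Z″)² sin W`, `V‴ = -(1/2) q Z″ cos²(W/2)`,
`∂^i y = 0` for `i = 1,…,4`, and `∂^5 y = (3/2) q (Z″)² cos²(W/2)` at `ξ₅`. -/
theorem stmt11 (q W Z U V y : ℝ → ℝ)
    (hq : ContDiff ℝ (⊤ : ℕ∞) q) (hW : ContDiff ℝ (⊤ : ℕ∞) W) (hZ : ContDiff ℝ (⊤ : ℕ∞) Z)
    (hy : ∀ ξ, deriv y ξ = q ξ * Real.cos (W ξ / 2) ^ 2 * Real.cos (Z ξ / 2) ^ 2)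
    (hU : ∀ ξ, deriv U ξ = q ξ / 2 * Real.sin (W ξ) * Real.cos (Z ξ / 2) ^ 2)
    (hV : ∀ ξ, deriv V ξ = q ξ / 2 * Real.cos (W ξ / 2) ^ 2 * Real.sin (Z ξ))
    (ξ₅ : ℝ) (hZπ : Z ξ₅ = π) (hZ' : deriv Z ξ₅ = 0) :
    (∀ i : ℕ, 1 ≤ i → i ≤ 4 → iteratedDeriv i U ξ₅ = 0) ∧
    iteratedDeriv 1 V ξ₅ = 0 ∧ iteratedDeriv 2 V ξ₅ = 0 ∧
    iteratedDeriv 5 U ξ₅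
      = (3 / 4) * q ξ₅ * (iteratedDeriv 2 Z ξ₅) ^ 2 * Real.sin (W ξ₅) ∧
    iteratedDeriv 3 V ξ₅
      = -(1 / 2) * q ξ₅ * iteratedDeriv 2 Z ξ₅ * Real.cos (W ξ₅ / 2) ^ 2 ∧
    (∀ i : ℕ, 1 ≤ i → i ≤ 4 → iteratedDeriv i y ξ₅ = 0) ∧
    iteratedDeriv 5 y ξ₅
      = (3 / 2) * q ξ₅ * (iteratedDeriv 2 Z ξ₅) ^ 2 * Real.cos (W ξ₅ / 2) ^ 2 := by
  have hC : ContDiff ℝ (⊤ : ℕ∞) (fun t => Real.cos (Z t / 2)) :=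
    Real.contDiff_cos.comp (hZ.div_const 2)
  have hD : ContDiff ℝ (⊤ : ℕ∞) (fun t => Real.sin (Z t)) := Real.contDiff_sin.comp hZ
  have hCW : ContDiff ℝ (⊤ : ℕ∞) (fun t => Real.cos (W t / 2) ^ 2) :=
    (Real.contDiff_cos.comp (hW.div_const 2)).pow 2
  have hSW : ContDiff ℝ (⊤ : ℕ∞) (fun t => Real.sin (W t)) := Real.contDiff_sin.comp hW
  obtain ⟨c1, c2⟩ := aux_comp Z (fun t => Real.cos (t / 2)) (fun t => -Real.sin (t / 2) * (1 / 2))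
    (fun t => -(Real.cos (t / 2) * (1 / 2)) * (1 / 2)) hZ ξ₅ hZ'
    (fun t => ((hasDerivAt_id t).div_const 2).cos)
    (fun t => (((hasDerivAt_id t).div_const 2).sin.neg).mul_const (1 / 2))
  obtain ⟨d1, d2⟩ := aux_comp Z Real.sin Real.cos (fun t => -Real.sin t) hZ ξ₅ hZ'
    Real.hasDerivAt_sin Real.hasDerivAt_cos
  have c0 : Real.cos (Z ξ₅ / 2) = 0 := by rw [hZπ]; exact Real.cos_pi_div_two
  have d0 : Real.sin (Z ξ₅) = 0 := by rw [hZπ]; exact Real.sin_pi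
  obtain ⟨s1, s2⟩ := aux_sq_s11 _ hC ξ₅ c0 c1
  rw [c2] at s2
  simp only [hZπ, Real.sin_pi_div_two] at s2
  simp only [hZπ, Real.cos_pi] at d2
  obtain ⟨y1, y2⟩ := aux_mul (fun t => q t * Real.cos (W t / 2) ^ 2) _ (hq.mul hCW) (hC.pow 2) ξ₅ 4 s1
  obtain ⟨u1, u2⟩ := aux_mul (fun t => q t / 2 * Real.sin (W t)) _ ((hq.div_const 2).mul hSW)
    (hC.pow 2) ξ₅ 4 s1
  obtain ⟨v1, v2⟩ := aux_mul (fun t => q t / 2 * Real.cos (W t / 2) ^ 2) _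
    ((hq.div_const 2).mul hCW) hD ξ₅ 2 (by
      intro k hk
      interval_cases k
      · simpa using d0
      · exact d1)
  rw [s2] at y2 u2
  rw [d2] at v2
  have ey : deriv y = _ := funext hy
  have eU : deriv U = _ := funext hU
  have eV : deriv V = _ := funext hV
  refine ⟨?_, ?_, ?_, ?_, ?_, ?_, ?_⟩
  · intro i h1 h4
    obtain ⟨k, rfl⟩ := Nat.exists_eq_add_of_le' h1
    rw [iteratedDeriv_succ', eU]
    exact u1 k (by omega)
  · rw [iteratedDeriv_succ', eV]
    exact v1 0 (by omega)
  · rw [iteratedDeriv_succ', eV]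
    exact v1 1 (by omega)
  · rw [iteratedDeriv_succ', eU]
    refine u2.trans ?_
    ring
  · rw [iteratedDeriv_succ', eV]
    refine v2.trans ?_
    ring
  · intro i h1 h4
    obtain ⟨k, rfl⟩ := Nat.exists_eq_add_of_le' h1
    rw [iteratedDeriv_succ', ey]
    exact y1 k (by omega)
  · rw [iteratedDeriv_succ', ey]
    refine y2.trans ?_
    ring
end

section
/- Let u, v : ℝ → ℝ be continuously differentiable with u, u′, v, v′ all square-integrable on ℝ, and set E_u = ∫_ℝ (u² + (u′)²) dx and E_v = ∫_ℝ (v² + (v′)²) dx. Define P₁(x) = (1/2) ∫_ℝ e^{-|x−y|} ( u(y)² v(y) + u(y) u′(y) v′(y) + (1/2) v(y) u′(y)² ) dy. Then for every x ∈ ℝ one has |P₁(x)| ≤ 2 E_u √(E_v). -/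
open MeasureTheory

lemma sobolev_aux (f : ℝ → ℝ) (hf : ContDiff ℝ 1 f)
    (h2 : Integrable (fun x => (f x) ^ 2))
    (h'2 : Integrable (fun x => (deriv f x) ^ 2)) (x : ℝ) :
    (f x) ^ 2 ≤ ∫ x, ((f x) ^ 2 + (deriv f x) ^ 2) := by
  have hc : Continuous f := hf.continuous
  have hc' : Continuous (deriv f) := hf.continuous_deriv le_rfl
  have hd : ∀ y, HasDerivAt (fun y => (f y) ^ 2) (2 * f y * deriv f y) y := by
    intro y
    have := ((hf.differentiable (by norm_num)) y).hasDerivAt.pow 2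
    have e : 2 * f y * deriv f y = ((2 : ℕ) : ℝ) * f y ^ (2 - 1) * deriv f y := by norm_num
    rw [e]
    exact this
  have hE : Integrable (fun x => (f x) ^ 2 + (deriv f x) ^ 2) := h2.add h'2
  have hI : Integrable (fun y => 2 * f y * deriv f y) := by
    refine hE.mono' (by fun_prop) (Filter.Eventually.of_forall fun y => ?_)
    rw [Real.norm_eq_abs, abs_le]
    constructor <;> nlinarith [sq_nonneg (f y + deriv f y), sq_nonneg (f y - deriv f y)]
  have ht := tendsto_zero_of_hasDerivAt_of_integrableOn_Iic (a := x) (fun y _ => hd y)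
    hI.integrableOn h2.integrableOn
  have h := integral_Iic_of_hasDerivAt_of_tendsto' (a := x) (fun y _ => hd y) hI.integrableOn ht
  rw [sub_zero] at h
  rw [← h]
  calc _ ≤ ∫ y in Set.Iic x, ((f y) ^ 2 + (deriv f y) ^ 2) :=
        setIntegral_mono hI.integrableOn hE.integrableOn
          (fun y => by nlinarith [sq_nonneg (f y - deriv f y)])
    _ ≤ _ := setIntegral_le_integral hE (Filter.Eventually.of_forall fun y => by positivity)


/-- Estimate (4.10) (with `p = ∞`) for the first nonlocal term
`P₁ = (1 - ∂_x²)^{-1}(u²v + u u_x v_x + (1/2) v u_x²)` of the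
two-component Novikov system: with
`E_u = ∫ (u² + (u′)²)` and `E_v = ∫ (v² + (v′)²)`, one has
`|P₁(x)| ≤ 2 E_u √E_v` for every `x`. -/
theorem stmt18 (u v : ℝ → ℝ) (hu : ContDiff ℝ 1 u) (hv : ContDiff ℝ 1 v)
    (hu2 : Integrable (fun x => (u x) ^ 2))
    (hu'2 : Integrable (fun x => (deriv u x) ^ 2))
    (hv2 : Integrable (fun x => (v x) ^ 2))
    (hv'2 : Integrable (fun x => (deriv v x) ^ 2)) :
    ∀ x : ℝ,
      |(1 / 2) * ∫ y, Real.exp (-|x - y|) *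
          ((u y) ^ 2 * v y + u y * deriv u y * deriv v y
            + (1 / 2) * v y * (deriv u y) ^ 2)|
        ≤ 2 * (∫ x, ((u x) ^ 2 + (deriv u x) ^ 2)) *
            Real.sqrt (∫ x, ((v x) ^ 2 + (deriv v x) ^ 2)) := by

  intro x
  have hus := sobolev_aux u hu hu2 hu'2
  have hvs := sobolev_aux v hv hv2 hv'2
  have hEu : Integrable (fun x => (u x) ^ 2 + (deriv u x) ^ 2) := hu2.add hu'2
  have hEv : Integrable (fun x => (v x) ^ 2 + (deriv v x) ^ 2) := hv2.add hv'2
  set A := ∫ x, ((u x) ^ 2 + (deriv u x) ^ 2) with hA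
  set B := ∫ x, ((v x) ^ 2 + (deriv v x) ^ 2) with hB
  have hA0 : 0 ≤ A := le_trans (sq_nonneg _) (hus 0)
  have hB0 : 0 ≤ B := le_trans (sq_nonneg _) (hvs 0)
  set S := Real.sqrt B with hS
  have hS0 : 0 ≤ S := Real.sqrt_nonneg _
  have hSS : S ^ 2 = B := Real.sq_sqrt hB0
  have hvS : ∀ y, |v y| ≤ S := fun y => Real.abs_le_sqrt (hvs y)
  rcases hS0.eq_or_lt with h0 | hpos
  · have hv0 : v = fun _ => 0 := by
      funext y
      have := hvS y
      rw [← h0] at this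
      exact abs_nonpos_iff.mp this
    have : ∀ y, deriv v y = 0 := by intro y; rw [hv0]; simp
    have hv0' : ∀ y, v y = 0 := fun y => by rw [hv0]
    simp only [this, hv0', ← h0]
    simp
  have hg : Integrable (fun y => S * ((u y) ^ 2 + (deriv u y) ^ 2)
      + A / (2 * S) * ((v y) ^ 2 + (deriv v y) ^ 2)) :=
    (hEu.const_mul S).add (hEv.const_mul _)
  have key : ∀ y, ‖Real.exp (-|x - y|) *
          ((u y) ^ 2 * v y + u y * deriv u y * deriv v y
            + (1 / 2) * v y * (deriv u y) ^ 2)‖ ≤ S * ((u y) ^ 2 + (deriv u y) ^ 2)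
      + A / (2 * S) * ((v y) ^ 2 + (deriv v y) ^ 2) := by
    intro y
    have he : Real.exp (-|x - y|) ≤ 1 := Real.exp_le_one_iff.mpr (by simp)
    rw [norm_mul, Real.norm_eq_abs, Real.norm_eq_abs, Real.abs_exp]
    refine le_trans (mul_le_of_le_one_left (abs_nonneg _) he) ?_
    have hm : |u y * deriv u y * deriv v y| ≤
        S / 2 * (deriv u y) ^ 2 + A / (2 * S) * (deriv v y) ^ 2 := by
      have h1 : A / (2 * S) * (deriv v y) ^ 2 ≥ (u y) ^ 2 / (2 * S) * (deriv v y) ^ 2 := by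
        have := hus y
        gcongr
      have h2 : S / 2 * (deriv u y) ^ 2 + (u y) ^ 2 / (2 * S) * (deriv v y) ^ 2
          - |u y * deriv u y * deriv v y| =
          (S * |deriv u y| - |u y| * |deriv v y|) ^ 2 / (2 * S) := by
        rw [abs_mul, abs_mul, ← sq_abs (u y), ← sq_abs (deriv u y), ← sq_abs (deriv v y)]
        field_simp
        ring
      have h3 : 0 ≤ (S * |deriv u y| - |u y| * |deriv v y|) ^ 2 / (2 * S) := by positivity
      linarith
    have h4 : 0 ≤ A / (2 * S) * (v y) ^ 2 := by positivity
    have hv1 := abs_le.mp (hvS y)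
    have hm1 := abs_le.mp hm
    have a1 := mul_le_mul_of_nonneg_left hv1.1 (sq_nonneg (u y))
    have a2 := mul_le_mul_of_nonneg_left hv1.2 (sq_nonneg (u y))
    have a3 := mul_le_mul_of_nonneg_left hv1.1 (sq_nonneg (deriv u y))
    have a4 := mul_le_mul_of_nonneg_left hv1.2 (sq_nonneg (deriv u y))
    rw [abs_le]
    constructor <;> linarith [hm1.1, hm1.2]
  have hfin := norm_integral_le_of_norm_le hg (Filter.Eventually.of_forall key)
  rw [integral_add (hEu.const_mul S) (hEv.const_mul _), integral_const_mul, integral_const_mul,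
    ← hA, ← hB, Real.norm_eq_abs] at hfin
  have h5 : A / (2 * S) * B = A * S / 2 := by
    rw [← hSS]; field_simp
  rw [h5] at hfin
  rw [abs_mul, abs_of_pos (by norm_num : (0:ℝ) < 1 / 2)]
  have : 0 ≤ A * S := by positivity
  linarith
end
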